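/- arXiv:2211.01451 — 5 statements merged into one kernel-verified Lean document; each statement's English description precedes it below -/
import Mathlib

section
/- Let K, N be positive natural numbers, and let H, H' be K × N real matrices that agree in every column except possibly the n-th column, and suppose every column of H and of H' has Euclidean (ℓ₂) norm at most 1. Then the Frobenius norm of (1/N)(H Hᵀ − H' H'ᵀ) is at most 2/N. -/
open Matrix

theorem sum_sum_sq_mul_sub_mul {ι : Type*} [Fintype ι] (u v : ι → ℝ) :
    ∑ i, ∑ k, (u i * u k - v i * v k) ^ 2 =
      (∑ i, u i ^ 2) ^ 2 + (∑ i, v i ^ 2) ^ 2 - 2 * (∑ i, u i * v i) ^ 2 := by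
  simp only [sq, Finset.sum_mul_sum]
  simp only [Finset.mul_sum, ← Finset.sum_add_distrib,
    ← Finset.sum_sub_distrib]
  exact Finset.sum_congr rfl fun i _ => Finset.sum_congr rfl fun k _ => by ring

theorem mul_transpose_sub_apply_of_eq_off_col {m n : Type*} [Fintype n]
    {A B : Matrix m n ℝ} {j₀ : n} (h : ∀ j, j ≠ j₀ → ∀ i, A i j = B i j) (i k : m) :
    (A * Aᵀ - B * Bᵀ) i k = A i j₀ * A k j₀ - B i j₀ * B k j₀ := by
  simp only [Matrix.sub_apply, mul_apply, transpose_apply, ← Finset.sum_sub_distrib]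
  exact Fintype.sum_eq_single j₀ fun j hj => by rw [h j hj i, h j hj k, sub_self]

/-- For neighboring `K × N` matrices `H, H'` whose columns all have
Euclidean norm at most 1, the Frobenius norm of `(1/N)(H Hᵀ − H' H'ᵀ)` is at most `2/N`.
(This is the ℓ₂ sensitivity bound `Δ_A ≤ 2/N` for `A = (1/N) H Hᵀ`.) -/
theorem sensitivity_A (K N : ℕ) (hK : 0 < K) (hN : 0 < N)
    (H H' : Matrix (Fin K) (Fin N) ℝ) (n : Fin N)
    (hneighbor : ∀ j : Fin N, j ≠ n → ∀ i : Fin K, H i j = H' i j)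
    (hHcol : ∀ j : Fin N, Real.sqrt (∑ i, (H i j) ^ 2) ≤ 1)
    (hH'col : ∀ j : Fin N, Real.sqrt (∑ i, (H' i j) ^ 2) ≤ 1) :
    Real.sqrt (∑ i, ∑ k, ((((N : ℝ)⁻¹ • (H * Hᵀ - H' * H'ᵀ)) : Matrix (Fin K) (Fin K) ℝ) i k) ^ 2)
      ≤ 2 / N := by
  have hu : ∑ i, H i n ^ 2 ≤ 1 := Real.sqrt_le_one.mp (hHcol n)
  have hv : ∑ i, H' i n ^ 2 ≤ 1 := Real.sqrt_le_one.mp (hH'col n)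
  have hu₀ : 0 ≤ ∑ i, H i n ^ 2 := by positivity
  have hv₀ : 0 ≤ ∑ i, H' i n ^ 2 := by positivity
  refine Real.sqrt_le_iff.mpr ⟨by positivity, ?_⟩
  simp only [Matrix.smul_apply, smul_eq_mul, mul_transpose_sub_apply_of_eq_off_col hneighbor, mul_pow,
    ← Finset.mul_sum]
  rw [sum_sum_sq_mul_sub_mul (fun i => H i n) (fun i => H' i n), div_eq_inv_mul, mul_pow]
  gcongr
  nlinarith [sq_nonneg (∑ i, H i n * H' i n)]
end

section
/- Let D, K, N be positive natural numbers, let V, V' be D × N real matrices agreeing in every column except possibly the n-th, let H, H' be K × N real matrices agreeing in every column except possibly the n-th, and let R be a D × N real matrix. Suppose every column of V, V', and R has Euclidean norm at most 1, and every column of H and H' has Euclidean norm at most 1. Then the Frobenius norm of (1/N)((V − R) Hᵀ − (V' − R) H'ᵀ) is at most 4/N. -/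
open Matrix

/-- If two pairs of vectors have squared norms at most `a` and `b`, the squared Frobenius norm of the
difference of their outer products is at most `4 * a * b`. -/
theorem sum_sq_outer_sub_outer_le {ι κ : Type*} [Fintype ι] [Fintype κ] {a b : ℝ}
    {x x' : ι → ℝ} {y y' : κ → ℝ}
    (hx : ∑ i, x i ^ 2 ≤ a) (hx' : ∑ i, x' i ^ 2 ≤ a)
    (hy : ∑ k, y k ^ 2 ≤ b) (hy' : ∑ k, y' k ^ 2 ≤ b) :
    ∑ i, ∑ k, (x i * y k - x' i * y' k) ^ 2 ≤ 4 * a * b := by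
  have ha : 0 ≤ a := (Finset.sum_nonneg fun i _ => sq_nonneg (x i)).trans hx
  have hxy : (∑ i, x i ^ 2) * ∑ k, y k ^ 2 ≤ a * b :=
    mul_le_mul hx hy (Finset.sum_nonneg fun k _ => sq_nonneg (y k)) ha
  have hxy' : (∑ i, x' i ^ 2) * ∑ k, y' k ^ 2 ≤ a * b :=
    mul_le_mul hx' hy' (Finset.sum_nonneg fun k _ => sq_nonneg (y' k)) ha
  calc ∑ i, ∑ k, (x i * y k - x' i * y' k) ^ 2
      ≤ ∑ i, ∑ k, (2 * (x i ^ 2 * y k ^ 2) + 2 * (x' i ^ 2 * y' k ^ 2)) := by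
        gcongr with i _ k _
        nlinarith [sq_nonneg (x i * y k + x' i * y' k)]
    _ = 2 * ((∑ i, x i ^ 2) * ∑ k, y k ^ 2) + 2 * ((∑ i, x' i ^ 2) * ∑ k, y' k ^ 2) := by
        simp only [Finset.sum_add_distrib, ← Finset.mul_sum, Finset.sum_mul]
    _ ≤ 4 * a * b := by linarith

/-- The difference of two vectors of squared norm at most `1` has squared norm at most `4`. -/
theorem sum_sq_sub_le_four {ι : Type*} [Fintype ι] {x y : ι → ℝ}
    (hx : ∑ i, x i ^ 2 ≤ 1) (hy : ∑ i, y i ^ 2 ≤ 1) : ∑ i, (x i - y i) ^ 2 ≤ 4 := by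
  calc ∑ i, (x i - y i) ^ 2 ≤ ∑ i, (2 * x i ^ 2 + 2 * y i ^ 2) := by
        gcongr with i
        nlinarith [sq_nonneg (x i + y i)]
    _ = 2 * ∑ i, x i ^ 2 + 2 * ∑ i, y i ^ 2 := by
        simp only [Finset.sum_add_distrib, ← Finset.mul_sum]
    _ ≤ 4 := by linarith

/-- If `A, A'` and `B, B'` agree off column `n`, then `A * Bᵀ - A' * B'ᵀ` is the difference of the
outer products of their `n`-th columns. -/
theorem mul_transpose_sub_apply_of_eq_off_column {ι κ ν : Type*} [Fintype ν]
    {A A' : Matrix ι ν ℝ} {B B' : Matrix κ ν ℝ} {n : ν}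
    (hA : ∀ j, j ≠ n → ∀ i, A i j = A' i j) (hB : ∀ j, j ≠ n → ∀ k, B k j = B' k j)
    (i : ι) (k : κ) :
    (A * Bᵀ - A' * B'ᵀ) i k = A i n * B k n - A' i n * B' k n := by
  simp only [Matrix.sub_apply, mul_apply, transpose_apply, ← Finset.sum_sub_distrib]
  refine Fintype.sum_eq_single n fun j hj => ?_
  rw [hA j hj, hB j hj, sub_self]

/-- For neighboring `V, V'` and neighboring `H, H'`, and outlier matrix `R`,
with all columns of `V, V', R` of Euclidean norm at most 1 and all columns of `H, H'` of
Euclidean norm at most 1, the Frobenius norm of `(1/N)((V − R) Hᵀ − (V' − R) H'ᵀ)` is at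
most `4/N`. (This is the sensitivity bound `Δ_B ≤ 4/N` for `B = (1/N)(V − R) Hᵀ`.) -/
theorem sensitivity_B (D K N : ℕ) (hD : 0 < D) (hK : 0 < K) (hN : 0 < N)
    (V V' R : Matrix (Fin D) (Fin N) ℝ) (H H' : Matrix (Fin K) (Fin N) ℝ) (n : Fin N)
    (hV : ∀ j : Fin N, j ≠ n → ∀ i : Fin D, V i j = V' i j)
    (hH : ∀ j : Fin N, j ≠ n → ∀ i : Fin K, H i j = H' i j)
    (hVcol : ∀ j : Fin N, Real.sqrt (∑ i, (V i j) ^ 2) ≤ 1)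
    (hV'col : ∀ j : Fin N, Real.sqrt (∑ i, (V' i j) ^ 2) ≤ 1)
    (hRcol : ∀ j : Fin N, Real.sqrt (∑ i, (R i j) ^ 2) ≤ 1)
    (hHcol : ∀ j : Fin N, Real.sqrt (∑ i, (H i j) ^ 2) ≤ 1)
    (hH'col : ∀ j : Fin N, Real.sqrt (∑ i, (H' i j) ^ 2) ≤ 1) :
    Real.sqrt (∑ i, ∑ k,
        ((((N : ℝ)⁻¹ • ((V - R) * Hᵀ - (V' - R) * H'ᵀ)) : Matrix (Fin D) (Fin K) ℝ) i k) ^ 2)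
      ≤ 4 / N := by
  simp only [Real.sqrt_le_iff, zero_le_one, true_and, one_pow] at hVcol hV'col hRcol hHcol hH'col
  have hA : ∀ j, j ≠ n → ∀ i, (V - R) i j = (V' - R) i j := fun j hj i => by
    rw [Matrix.sub_apply, Matrix.sub_apply, hV j hj]
  have hsum := sum_sq_outer_sub_outer_le (sum_sq_sub_le_four (hVcol n) (hRcol n))
    (sum_sq_sub_le_four (hV'col n) (hRcol n)) (hHcol n) (hH'col n)
  refine Real.sqrt_le_iff.mpr ⟨by positivity, ?_⟩
  simp only [Matrix.smul_apply, mul_transpose_sub_apply_of_eq_off_column hA hH, smul_eq_mul,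
    mul_pow, ← Finset.mul_sum, Matrix.sub_apply]
  calc ((N : ℝ)⁻¹) ^ 2 * ∑ i, ∑ k, ((V i n - R i n) * H k n - (V' i n - R i n) * H' k n) ^ 2
      ≤ ((N : ℝ)⁻¹) ^ 2 * (4 * 4 * 1) := by gcongr
    _ = (4 / (N : ℝ)) ^ 2 := by ring
end

section
/- Let λ ≥ 0 and M > 0 be real numbers, let x be a real number, and define S_{λ,M}(x) = 0 if |x| < λ; S_{λ,M}(x) = x − sign(x)·λ if λ ≤ |x| ≤ λ + M; and S_{λ,M}(x) = sign(x)·M if |x| > λ + M. Then S_{λ,M}(x) lies in the interval [−M, M], and for every real r with |r| ≤ M, (1/2)(x − S_{λ,M}(x))² + λ|S_{λ,M}(x)| ≤ (1/2)(x − r)² + λ|r|; that is, S_{λ,M}(x) is a minimizer of r ↦ (1/2)(x − r)² + λ|r| over [−M, M], and it is the unique minimizer. -/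
/-- The clipped soft-thresholding operator `S_{λ,M}` on the reals:
`S_{λ,M}(x) = 0` if `|x| < λ`, `x − sign(x)·λ` if `λ ≤ |x| ≤ λ + M`, and
`sign(x)·M` if `|x| > λ + M`. -/
noncomputable def softClip (lam M x : ℝ) : ℝ :=
  if |x| < lam then 0
  else if |x| ≤ lam + M then x - Real.sign x * lam
  else Real.sign x * M

theorem softClip_mem_Icc {lam M : ℝ} (hlam : 0 ≤ lam) (hM : 0 < M) (x : ℝ) :
    softClip lam M x ∈ Set.Icc (-M) M := by
  unfold softClip
  rw [Set.mem_Icc]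
  rcases lt_trichotomy x 0 with hx | rfl | hx
  · rw [Real.sign_of_neg hx, abs_of_neg hx]
    split_ifs <;> constructor <;> linarith
  · rw [Real.sign_zero, abs_zero]
    split_ifs <;> constructor <;> linarith
  · rw [Real.sign_of_pos hx, abs_of_pos hx]
    split_ifs <;> constructor <;> linarith

/-- The first-order optimality condition (variational inequality) at `softClip lam M x`. -/
theorem softClip_variational_inequality {lam M : ℝ} (hlam : 0 ≤ lam) (hM : 0 < M) (x : ℝ)
    {r : ℝ} (hr : |r| ≤ M) :
    0 ≤ (softClip lam M x - x) * (r - softClip lam M x) +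
      lam * (|r| - |softClip lam M x|) := by
  obtain ⟨hr₁, hr₂⟩ := abs_le.mp hr
  have hpos : 0 ≤ lam * (|r| - r) := mul_nonneg hlam (sub_nonneg.mpr (le_abs_self r))
  have hneg : 0 ≤ lam * (|r| + r) := mul_nonneg hlam (by linarith [neg_abs_le r])
  unfold softClip
  split_ifs with h₁ h₂
  · have hxr : x * r ≤ lam * |r| :=
      (le_abs_self _).trans ((abs_mul x r).trans_le (by gcongr))
    simp only [abs_zero]
    linarith
  · rw [not_lt] at h₁
    rcases lt_trichotomy x 0 with hx | rfl | hx
    · rw [abs_of_neg hx] at h₁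
      rw [Real.sign_of_neg hx, abs_of_nonpos (a := x - -1 * lam) (by linarith)]
      linarith
    · rw [Real.sign_zero]
      simp only [zero_mul, sub_zero, abs_zero, zero_add]
      positivity
    · rw [abs_of_pos hx] at h₁
      rw [Real.sign_of_pos hx, abs_of_nonneg (a := x - 1 * lam) (by linarith)]
      linarith
  · rw [not_le] at h₂
    rcases lt_trichotomy x 0 with hx | rfl | hx
    · rw [abs_of_neg hx] at h₂
      rw [Real.sign_of_neg hx, neg_one_mul, abs_neg, abs_of_pos hM]
      have := mul_nonneg (sub_nonneg.mpr h₂.le) (neg_le_iff_add_nonneg.mp hr₁)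
      linarith
    · rw [abs_zero] at h₂
      linarith
    · rw [abs_of_pos hx] at h₂
      rw [Real.sign_of_pos hx, one_mul, abs_of_pos hM]
      have := mul_nonneg (sub_nonneg.mpr h₂.le) (sub_nonneg.mpr hr₂)
      linarith

/-- Quadratic growth of the objective `r ↦ (1/2)(x − r)² + λ|r|` around `softClip lam M x`. -/
theorem softClip_quadratic_growth {lam M : ℝ} (hlam : 0 ≤ lam) (hM : 0 < M) (x : ℝ)
    {r : ℝ} (hr : |r| ≤ M) :
    (1 / 2) * (x - softClip lam M x) ^ 2 + lam * |softClip lam M x| +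
        (1 / 2) * (r - softClip lam M x) ^ 2 ≤
      (1 / 2) * (x - r) ^ 2 + lam * |r| := by
  linarith [softClip_variational_inequality hlam hM x hr]

/-- for `λ ≥ 0`, `M > 0` and any real `x`, `S_{λ,M}(x) ∈ [−M, M]` and
`S_{λ,M}(x)` is the unique minimizer of `r ↦ (1/2)(x − r)² + λ|r|` over `[−M, M]`. -/
theorem softClip_is_unique_minimizer (lam M x : ℝ) (hlam : 0 ≤ lam) (hM : 0 < M) :
    softClip lam M x ∈ Set.Icc (-M) M ∧
    (∀ r : ℝ, |r| ≤ M →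
      (1 / 2) * (x - softClip lam M x) ^ 2 + lam * |softClip lam M x| ≤
        (1 / 2) * (x - r) ^ 2 + lam * |r|) ∧
    (∀ r : ℝ, |r| ≤ M →
      (1 / 2) * (x - r) ^ 2 + lam * |r| =
        (1 / 2) * (x - softClip lam M x) ^ 2 + lam * |softClip lam M x| →
      r = softClip lam M x) := by
  refine ⟨softClip_mem_Icc hlam hM x, fun r hr => ?_, fun r hr heq => ?_⟩
  · linarith [softClip_quadratic_growth hlam hM x hr, sq_nonneg (r - softClip lam M x)]
  · have hsq : (r - softClip lam M x) ^ 2 ≤ 0 := by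
      linarith [softClip_quadratic_growth hlam hM x hr]
    exact sub_eq_zero.mp (pow_eq_zero_iff two_ne_zero |>.mp (hsq.antisymm (sq_nonneg _)))
end

section
/- Let D, N be positive natural numbers, let λ ≥ 0 and M > 0 be real numbers, and let X be a D × N real matrix. Let R* be the D × N matrix obtained by applying the clipped soft-thresholding operator S_{λ,M} entrywise to X. Then every entry of R* has absolute value at most M, and for every D × N real matrix R all of whose entries have absolute value at most M, (1/N)[(1/2)‖X − R*‖_F² + λ‖R*‖_{1,1}] ≤ (1/N)[(1/2)‖X − R‖_F² + λ‖R‖_{1,1}]; that is, R* minimizes R ↦ (1/N)[(1/2)‖X − R‖_F² + λ‖R‖_{1,1}] over the set {R : ‖rₙ‖_∞ ≤ M for every column rₙ of R}. -/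
theorem abs_softClip_le (lam : ℝ) {M : ℝ} (hM : 0 < M) (x : ℝ) :
    |softClip lam M x| ≤ M := by
  unfold softClip
  rcases lt_trichotomy x 0 with hx | rfl | hx
  · rw [abs_of_neg hx, Real.sign_of_neg hx]
    split_ifs <;> rw [abs_le] <;> constructor <;> linarith
  · simp [hM.le]
  · rw [abs_of_pos hx, Real.sign_of_pos hx]
    split_ifs <;> rw [abs_le] <;> constructor <;> linarith

/-- `softClip lam M x` minimizes `r ↦ (x - r) ^ 2 / 2 + lam * |r|` over `[-M, M]`. -/
theorem softClip_le_of_abs_le {lam M : ℝ} (hlam : 0 ≤ lam) (hM : 0 < M) (x : ℝ) {r : ℝ}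
    (hr : |r| ≤ M) :
    (1 / 2) * (x - softClip lam M x) ^ 2 + lam * |softClip lam M x| ≤
      (1 / 2) * (x - r) ^ 2 + lam * |r| := by
  have hpos : lam * r ≤ lam * |r| := mul_le_mul_of_nonneg_left (le_abs_self r) hlam
  have hneg : lam * -r ≤ lam * |r| := mul_le_mul_of_nonneg_left (neg_le_abs r) hlam
  obtain ⟨hr₁, hr₂⟩ := abs_le.mp hr
  unfold softClip
  split_ifs with h₁ h₂
  · have hxr : x * r ≤ lam * |r| :=
      (le_abs_self _).trans ((abs_mul x r).trans_le
        (mul_le_mul_of_nonneg_right h₁.le (abs_nonneg r)))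
    rw [abs_zero]
    nlinarith [sq_nonneg r]
  · rcases lt_trichotomy x 0 with hx | rfl | hx
    · rw [abs_of_neg hx] at h₁
      rw [Real.sign_of_neg hx, abs_of_nonpos (by linarith)]
      nlinarith [sq_nonneg (x - r + lam)]
    · simp only [Real.sign_zero, zero_mul, sub_zero, abs_zero, mul_zero]
      nlinarith [sq_nonneg r, mul_nonneg hlam (abs_nonneg r)]
    · rw [abs_of_pos hx] at h₁
      rw [Real.sign_of_pos hx, abs_of_nonneg (by linarith)]
      nlinarith [sq_nonneg (x - r - lam)]
  · rcases lt_trichotomy x 0 with hx | rfl | hx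
    · rw [abs_of_neg hx] at h₂
      rw [Real.sign_of_neg hx, abs_of_nonpos (by linarith)]
      nlinarith [sq_nonneg (M + r),
        mul_nonneg (show 0 ≤ M + r by linarith) (show 0 ≤ -x - lam - M by linarith)]
    · rw [abs_zero] at h₂
      linarith
    · rw [abs_of_pos hx] at h₂
      rw [Real.sign_of_pos hx, abs_of_nonneg (by linarith)]
      nlinarith [sq_nonneg (M - r),
        mul_nonneg (show 0 ≤ M - r by linarith) (show 0 ≤ x - lam - M by linarith)]

/-- applying `S_{λ,M}` entrywise to `X` yields a matrix `R*` with all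
entries in `[−M, M]` minimizing `R ↦ (1/N)[(1/2)‖X − R‖_F² + λ‖R‖₁,₁]` over the set of
matrices all of whose entries have absolute value at most `M`. -/
theorem softClip_matrix_minimizer (D N : ℕ) (hD : 0 < D) (hN : 0 < N)
    (lam M : ℝ) (hlam : 0 ≤ lam) (hM : 0 < M) (X : Matrix (Fin D) (Fin N) ℝ) :
    ∀ Rstar : Matrix (Fin D) (Fin N) ℝ, Rstar = (fun i j => softClip lam M (X i j)) →
      (∀ i j, |Rstar i j| ≤ M) ∧
      (∀ R : Matrix (Fin D) (Fin N) ℝ, (∀ i j, |R i j| ≤ M) →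
        (1 / (N : ℝ)) * ((1 / 2) * ∑ i, ∑ j, (X i j - Rstar i j) ^ 2
            + lam * ∑ i, ∑ j, |Rstar i j|) ≤
          (1 / (N : ℝ)) * ((1 / 2) * ∑ i, ∑ j, (X i j - R i j) ^ 2
            + lam * ∑ i, ∑ j, |R i j|)) := by
  rintro _ rfl
  refine ⟨fun i j => abs_softClip_le lam hM (X i j), fun R hR => ?_⟩
  refine mul_le_mul_of_nonneg_left ?_ (by positivity)
  simp only [Finset.mul_sum, ← Finset.sum_add_distrib]
  exact Finset.sum_le_sum fun i _ => Finset.sum_le_sum fun j _ =>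
    softClip_le_of_abs_le hlam hM (X i j) (hR i j)
end

section
/- Let D be a positive natural number and let v ∈ ℝ^D. Let p = P₊(v) be the entrywise nonnegative part of v (p_i = max(v_i, 0)), and define w* = p / max(1, ‖p‖₂). Then w* is entrywise nonnegative with ‖w*‖₂ ≤ 1, and for every w ∈ ℝ^D that is entrywise nonnegative with ‖w‖₂ ≤ 1, ‖w* − v‖₂ ≤ ‖w − v‖₂; that is, w* is the Euclidean projection of v onto the intersection of the nonnegative orthant with the closed unit ℓ₂ ball. -/
open scoped RealInnerProductSpace in
/-- The variational inequality at `x` gives the distance-minimizing property of `x`. -/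
theorem norm_sub_le_norm_sub_of_inner_nonpos {E : Type*} [NormedAddCommGroup E]
    [InnerProductSpace ℝ E] {v x w : E} (h : ⟪w - x, v - x⟫ ≤ 0) : ‖x - v‖ ≤ ‖w - v‖ := by
  have key : ‖w - v‖ ^ 2 = ‖w - x‖ ^ 2 - 2 * ⟪w - x, v - x⟫ + ‖v - x‖ ^ 2 := by
    rw [← norm_sub_sq_real, sub_sub_sub_cancel_right]
  rw [norm_sub_rev x v]
  refine le_of_sq_le_sq ?_ (norm_nonneg _)
  nlinarith [sq_nonneg ‖w - x‖]

/-- for `v ∈ ℝ^D`, with `p = P₊(v)` the entrywise nonnegative part of `v`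
and `w* = p / max(1, ‖p‖₂)`, the vector `w*` is entrywise nonnegative with `‖w*‖₂ ≤ 1`,
and `w*` is the Euclidean projection of `v` onto the intersection of the nonnegative
orthant with the closed unit ℓ₂ ball. -/
theorem projection_onto_nonneg_unit_ball (D : ℕ) (hD : 0 < D)
    (v : EuclideanSpace ℝ (Fin D)) :
    ∀ p wstar : EuclideanSpace ℝ (Fin D),
      p = (fun i => max (v i) 0) → wstar = (max 1 ‖p‖)⁻¹ • p →
      (∀ i, 0 ≤ wstar i) ∧ ‖wstar‖ ≤ 1 ∧
      (∀ w : EuclideanSpace ℝ (Fin D), (∀ i, 0 ≤ w i) → ‖w‖ ≤ 1 →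
        ‖wstar - v‖ ≤ ‖w - v‖) := by
  intro p x hp hx
  have hpi (i : Fin D) : p i = max (v i) 0 := congrFun hp i
  have hm : 0 < max 1 ‖p‖ := lt_max_of_lt_left one_pos
  have hp0 (i : Fin D) : 0 ≤ p i := hpi i ▸ le_max_right _ _
  subst hx
  refine ⟨fun i => mul_nonneg (inv_nonneg.2 hm.le) (hp0 i), ?_, fun w hw hw1 => ?_⟩
  · rw [norm_smul, norm_inv, Real.norm_of_nonneg hm.le, inv_mul_le_one₀ hm]
    exact le_max_right _ _
  · apply norm_sub_le_norm_sub_of_inner_nonpos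
    have hwv : inner ℝ w (v - p) ≤ 0 := by
      rw [PiLp.inner_apply]
      refine Finset.sum_nonpos fun i _ => ?_
      have hvp : v i - p i ≤ 0 := sub_nonpos.2 (hpi i ▸ le_max_left _ _)
      simpa [mul_comm] using mul_nonpos_of_nonneg_of_nonpos (hw i) hvp
    have hpv : inner ℝ p (v - p) = 0 := by
      rw [PiLp.inner_apply]
      refine Finset.sum_eq_zero fun i _ => ?_
      rcases le_total (v i) 0 with h | h <;> simp [hpi, h]
    have hwp : inner ℝ w p ≤ ‖p‖ :=
      (real_inner_le_norm w p).trans (mul_le_of_le_one_left (norm_nonneg p) hw1)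
    have hpp := real_inner_self_eq_norm_sq p
    simp only [inner_sub_left, inner_sub_right, real_inner_smul_left, real_inner_smul_right]
      at hwv hpv ⊢
    rcases le_total ‖p‖ 1 with h | h
    · rw [max_eq_left h]
      linarith
    · rw [max_eq_right h]
      have hs : ‖p‖⁻¹ * ‖p‖ = 1 := inv_mul_cancel₀ (by positivity)
      have hs1 : ‖p‖⁻¹ ≤ 1 := inv_le_one_of_one_le₀ h
      have hpv' : inner ℝ p v = ‖p‖ ^ 2 := by linarith
      have e : ‖p‖⁻¹ * ‖p‖ ^ 2 = ‖p‖ := by rw [pow_two, ← mul_assoc, hs, one_mul]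
      rw [hpv', hpp, e, hs]
      nlinarith [mul_nonneg (sub_nonneg.2 hs1) (sub_nonneg.2 hwp)]
end
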